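/- arXiv:1805.10615 — 4 statements merged into one kernel-verified Lean document; each statement's English description precedes it below -/
import Mathlib

section
/- Let T > 0, M̃ > 0, and let x : ℝ → ℝ be differentiable on [0,T] with |x'(t)| ≤ M̃ for all t ∈ [0,T]. Let M := sup_{t ∈ [0,T]} |x(t)| and assume T ≥ 2M/M̃. Then M² ≤ 2 M̃ · ∫₀ᵀ |x(s)| ds. -/
/-- Precise form of Lemma 1 of the supplementary material: if `|x'| ≤ M̃` on
`[0,T]`, `M = sup_{[0,T]} |x|` and `T ≥ 2M/M̃`, then `M² ≤ 2 M̃ ∫₀ᵀ |x|`. -/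
theorem stmt_6 (T Mtilde : ℝ) (hT : 0 < T) (hMtilde : 0 < Mtilde)
    (x x' : ℝ → ℝ)
    (hderiv : ∀ t ∈ Set.Icc (0:ℝ) T, HasDerivAt x (x' t) t)
    (hbound : ∀ t ∈ Set.Icc (0:ℝ) T, |x' t| ≤ Mtilde)
    (M : ℝ) (hM : M = sSup ((fun t => |x t|) '' Set.Icc (0:ℝ) T))
    (hTM : T ≥ 2 * M / Mtilde) :
    M ^ 2 ≤ 2 * Mtilde * ∫ s in (0:ℝ)..T, |x s| := by
  have hcont : ContinuousOn (fun t => |x t|) (Set.Icc 0 T) :=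
    fun t ht => ((hderiv t ht).continuousAt.abs).continuousWithinAt
  obtain ⟨c, hc, hcs⟩ := isCompact_Icc.exists_sSup_image_eq
    (Set.nonempty_Icc.mpr hT.le) hcont
  have hMc : M = |x c| := hM.trans hcs
  have hM0 : 0 ≤ M := hMc ▸ abs_nonneg _
  have hlip : ∀ s ∈ Set.Icc (0:ℝ) T, M - Mtilde * |s - c| ≤ |x s| := by
    intro s hs
    have h := (convex_Icc (0:ℝ) T).norm_image_sub_le_of_norm_hasDerivWithin_le
      (fun t ht => (hderiv t ht).hasDerivWithinAt) hbound hs hc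
    rw [Real.norm_eq_abs, Real.norm_eq_abs, abs_sub_comm c s] at h
    have h2 := abs_sub_abs_le_abs_sub (x c) (x s)
    linarith
  obtain ⟨L, hL⟩ : ∃ L, L = M / Mtilde := ⟨_, rfl⟩
  have hML : M = Mtilde * L := by rw [hL]; field_simp
  have hL0 : 0 ≤ L := hL ▸ div_nonneg hM0 hMtilde.le
  have hTL : 2 * L ≤ T := by rw [hL, ← mul_div_assoc]; exact hTM
  have hint : IntervalIntegrable (fun t => |x t|) MeasureTheory.volume 0 T := by
    apply ContinuousOn.intervalIntegrable
    rwa [Set.uIcc_of_le hT.le]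
  have key : ∀ a b, 0 ≤ a → a ≤ b → b ≤ T →
      (∫ s in a..b, (M - Mtilde * |s - c|)) ≤ ∫ s in (0:ℝ)..T, |x s| := by
    intro a b ha hab hb
    have h1 : (∫ s in a..b, (M - Mtilde * |s - c|)) ≤ ∫ s in a..b, |x s| := by
      apply intervalIntegral.integral_mono_on hab
      · exact Continuous.intervalIntegrable (by fun_prop) _ _
      · apply hint.mono_set
        rw [Set.uIcc_of_le hT.le, Set.uIcc_of_le hab]
        exact Set.Icc_subset_Icc ha hb
      · intro s hs
        exact hlip s ⟨ha.trans hs.1, hs.2.trans hb⟩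
    refine h1.trans (intervalIntegral.integral_mono_interval ha hab hb ?_ hint)
    exact Filter.Eventually.of_forall fun s => abs_nonneg _
  have fin : Mtilde * L ^ 2 / 2 ≤ ∫ s in (0:ℝ)..T, |x s| := by
    by_cases hcase : c + L ≤ T
    · refine le_trans (le_of_eq ?_) (key c (c + L) hc.1 (by linarith) hcase)
      have : (∫ s in c..(c + L), (M - Mtilde * |s - c|))
          = ∫ s in c..(c + L), (M - Mtilde * (s - c)) := by
        apply intervalIntegral.integral_congr
        intro s hs
        rw [Set.uIcc_of_le (by linarith)] at hs
        simp only [abs_of_nonneg (sub_nonneg.mpr hs.1)]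
      rw [this, intervalIntegral.integral_comp_sub_right (fun u => M - Mtilde * u) c,
        intervalIntegral.integral_sub (by simp) (Continuous.intervalIntegrable (by fun_prop) _ _)]
      rw [intervalIntegral.integral_const_mul, integral_id]
      simp
      rw [hML]; ring
    · refine le_trans (le_of_eq ?_) (key (c - L) c (by linarith) (by linarith) hc.2)
      have : (∫ s in (c - L)..c, (M - Mtilde * |s - c|))
          = ∫ s in (c - L)..c, (M + Mtilde * (s - c)) := by
        apply intervalIntegral.integral_congr
        intro s hs
        rw [Set.uIcc_of_le (by linarith)] at hs
        simp only [abs_of_nonpos (sub_nonpos.mpr hs.2)]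
        ring
      rw [this, intervalIntegral.integral_comp_sub_right (fun u => M + Mtilde * u) c,
        intervalIntegral.integral_add (by simp) (Continuous.intervalIntegrable (by fun_prop) _ _)]
      rw [intervalIntegral.integral_const_mul, integral_id]
      simp
      rw [hML]; ring
  calc M ^ 2 = 2 * Mtilde * (Mtilde * L ^ 2 / 2) := by rw [hML]; ring
    _ ≤ _ := by gcongr
end

section
/- Let T > 0, M̃ > 0, n ∈ ℕ with n ≥ 1, let f, f̂ : ℝ → ℝ, and let x, x̂ : ℝ → ℝ be differentiable on [0,T] with x'(t) = f(x(t)) and x̂'(t) = f̂(x̂(t)) for all t ∈ [0,T]. Set z := x − x̂ and assume: (i) z is continuously differentiable on [0,T] with |z'(t)| ≤ M̃ for all t ∈ [0,T]; (ii) there is a partition 0 = t₀ ≤ t₁ ≤ … ≤ tₙ = T such that z is monotone on each subinterval [tᵢ₋₁, tᵢ]; (iii) T ≥ 2 sup_{t ∈ [0,T]} |z(t)| / M̃. Then ( ∫₀ᵀ |f(x(t)) − f̂(x̂(t))| dt )² ≤ 8 n² M̃ · ∫₀ᵀ |x(t) − x̂(t)| dt. -/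
theorem piece_mono (a b : ℝ) (hab : a ≤ b) (z g : ℝ → ℝ)
    (hz : ∀ t ∈ Set.Icc a b, HasDerivAt z (g t) t)
    (hg : ContinuousOn g (Set.Icc a b)) (hm : MonotoneOn z (Set.Icc a b)) :
    ∫ s in a..b, |g s| = z b - z a := by
  rcases hab.eq_or_lt with rfl | hlt
  · simp
  have hI : IntervalIntegrable g MeasureTheory.volume a b :=
    ContinuousOn.intervalIntegrable (by rwa [Set.uIcc_of_le hab])
  rw [← intervalIntegral.integral_eq_sub_of_hasDerivAt
    (fun t ht => hz t (by rwa [Set.uIcc_of_le hab] at ht)) hI]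
  apply intervalIntegral.integral_congr
  intro t ht
  rw [Set.uIcc_of_le hab] at ht
  have h1 := (hz t ht).hasDerivWithinAt.derivWithin (uniqueDiffOn_Icc hlt t ht)
  have h2 : 0 ≤ derivWithin z (Set.Icc a b) t := hm.derivWithin_nonneg
  rw [h1] at h2
  exact abs_of_nonneg h2

theorem piece_le (a b S : ℝ) (hab : a ≤ b) (z g : ℝ → ℝ)
    (hz : ∀ t ∈ Set.Icc a b, HasDerivAt z (g t) t)
    (hg : ContinuousOn g (Set.Icc a b))
    (hm : MonotoneOn z (Set.Icc a b) ∨ AntitoneOn z (Set.Icc a b))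
    (hS : ∀ t ∈ Set.Icc a b, |z t| ≤ S) :
    ∫ s in a..b, |g s| ≤ 2 * S := by
  have ha := abs_le.1 (hS a ⟨le_rfl, hab⟩)
  have hb := abs_le.1 (hS b ⟨hab, le_rfl⟩)
  rcases hm with hm | hm
  · rw [piece_mono a b hab z g hz hg hm]; linarith
  · have := piece_mono a b hab (fun t => -z t) (fun t => -g t)
      (fun t ht => (hz t ht).fun_neg) hg.fun_neg hm.neg
    simp only [abs_neg] at this
    rw [this]; linarith

theorem bump_right (a b S M : ℝ) (hM : 0 < M) (hS : 0 ≤ S) (hab : b - a = S / M) (w : ℝ → ℝ)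
    (hw : ContinuousOn w (Set.Icc a b)) (u v : ℝ)
    (hu : ∀ t ∈ Set.Icc a b, u + v * t ≤ w t)
    (huv : (b - a) * (u + v * ((a + b) / 2)) = S ^ 2 / (2 * M)) :
    S ^ 2 / (2 * M) ≤ ∫ s in a..b, w s := by
  have hle : a ≤ b := by
    have : 0 ≤ S / M := by positivity
    linarith
  have h1 : ∫ s in a..b, (u + v * s) = S ^ 2 / (2 * M) := by
    rw [← huv, intervalIntegral.integral_add (by simp)
      (Continuous.intervalIntegrable (by fun_prop) _ _)]
    rw [intervalIntegral.integral_const_mul, integral_id, intervalIntegral.integral_const,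
      smul_eq_mul]
    ring
  rw [← h1]
  apply intervalIntegral.integral_mono_on hle (Continuous.intervalIntegrable (by fun_prop) _ _)
  · exact ContinuousOn.intervalIntegrable (by rwa [Set.uIcc_of_le hle])
  · exact hu

theorem sup_sq (T M S c : ℝ) (hM : 0 < M) (z g : ℝ → ℝ) (hS : 0 ≤ S)
    (hz : ∀ t ∈ Set.Icc (0:ℝ) T, HasDerivAt z (g t) t)
    (hg : ∀ t ∈ Set.Icc (0:ℝ) T, |g t| ≤ M) (hc : c ∈ Set.Icc (0:ℝ) T) (hcS : |z c| = S)
    (hT : 2 * (S / M) ≤ T) :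
    S ^ 2 / (2 * M) ≤ ∫ s in (0:ℝ)..T, |z s| := by
  have hT0 : 0 ≤ T := hc.1.trans hc.2
  have hzc : ContinuousOn (fun s => |z s|) (Set.Icc (0:ℝ) T) :=
    ContinuousOn.abs (fun t ht => (hz t ht).continuousAt.continuousWithinAt)
  have hlip : ∀ t ∈ Set.Icc (0:ℝ) T, S - M * |t - c| ≤ |z t| := by
    intro t ht
    have := (convex_Icc (0:ℝ) T).norm_image_sub_le_of_norm_hasDerivWithin_le
      (fun t ht => (hz t ht).hasDerivWithinAt) hg ht hc
    rw [Real.norm_eq_abs, Real.norm_eq_abs, abs_sub_comm c t] at this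
    have h3 := abs_sub_abs_le_abs_sub (z c) (z t)
    linarith
  have hint : IntervalIntegrable (fun s => |z s|) MeasureTheory.volume 0 T :=
    ContinuousOn.intervalIntegrable (by rwa [Set.uIcc_of_le hT0])
  have hd : 0 ≤ S / M := by positivity
  have key : ∀ a b, 0 ≤ a → a ≤ b → b ≤ T →
      S ^ 2 / (2 * M) ≤ ∫ s in a..b, |z s| → S ^ 2 / (2 * M) ≤ ∫ s in (0:ℝ)..T, |z s| := by
    intro a b h0 h1 h2 h
    refine h.trans (intervalIntegral.integral_mono_interval h0 h1 h2 ?_ hint)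
    exact Filter.Eventually.of_forall (fun s => abs_nonneg _)
  obtain ⟨hc0, hc1⟩ := hc
  by_cases h : c + S / M ≤ T
  · apply key c (c + S / M) hc0 (by linarith) h
    apply bump_right _ _ S M hM hS (by ring) _ (hzc.mono (Set.Icc_subset_Icc hc0 h)) (S + M * c) (-M)
    · intro t ht
      have := hlip t ⟨hc0.trans ht.1, ht.2.trans h⟩
      rw [abs_of_nonneg (by linarith [ht.1])] at this
      linarith
    · field_simp
      ring
  · have h' : 0 ≤ c - S / M := by linarith
    apply key (c - S / M) c h' (by linarith) hc1
    apply bump_right _ _ S M hM hS (by ring) _ (hzc.mono (Set.Icc_subset_Icc h' hc1)) (S - M * c) M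
    · intro t ht
      have := hlip t ⟨h'.trans ht.1, ht.2.trans hc1⟩
      rw [abs_of_nonpos (by linarith [ht.2])] at this
      linarith
    · field_simp
      ring

/-- Quantitative form of Theorem 2 of the paper: if `x` solves `ẋ = f(x)` and
`x̂` solves `ẋ̂ = f̂(x̂)` on `[0,T]`, `z := x − x̂` is C¹ with `|z'| ≤ M̃`,
piecewise monotone on `n` pieces, and `T ≥ 2 sup|z| / M̃`, then
`(∫₀ᵀ |f(x(·)) − f̂(x̂(·))|)² ≤ 8 n² M̃ ∫₀ᵀ |x − x̂|`. -/
theorem stmt_8 (T Mtilde : ℝ) (hT : 0 < T) (hMtilde : 0 < Mtilde)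
    (n : ℕ) (hn : 1 ≤ n) (f fhat x xhat : ℝ → ℝ)
    (hx : ∀ t ∈ Set.Icc (0:ℝ) T, HasDerivAt x (f (x t)) t)
    (hxhat : ∀ t ∈ Set.Icc (0:ℝ) T, HasDerivAt xhat (fhat (xhat t)) t)
    (hcont : ContinuousOn (fun t => f (x t) - fhat (xhat t)) (Set.Icc (0:ℝ) T))
    (hbound : ∀ t ∈ Set.Icc (0:ℝ) T, |f (x t) - fhat (xhat t)| ≤ Mtilde)
    (t : ℕ → ℝ) (ht0 : t 0 = 0) (htn : t n = T)
    (hmonot : ∀ i < n, t i ≤ t (i + 1))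
    (hpiece : ∀ i < n,
      MonotoneOn (fun s => x s - xhat s) (Set.Icc (t i) (t (i + 1))) ∨
        AntitoneOn (fun s => x s - xhat s) (Set.Icc (t i) (t (i + 1))))
    (hTM : T ≥ 2 * sSup ((fun s => |x s - xhat s|) '' Set.Icc (0:ℝ) T) / Mtilde) :
    (∫ s in (0:ℝ)..T, |f (x s) - fhat (xhat s)|) ^ 2
      ≤ 8 * (n : ℝ) ^ 2 * Mtilde * ∫ s in (0:ℝ)..T, |x s - xhat s| := by
  set z : ℝ → ℝ := fun s => x s - xhat s with hzdef
  set g : ℝ → ℝ := fun s => f (x s) - fhat (xhat s) with hgdef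
  have hz : ∀ t ∈ Set.Icc (0:ℝ) T, HasDerivAt z (g t) t :=
    fun t ht => (hx t ht).fun_sub (hxhat t ht)
  have hzc : ContinuousOn (fun s => |z s|) (Set.Icc (0:ℝ) T) :=
    ContinuousOn.abs (fun t ht => (hz t ht).continuousAt.continuousWithinAt)
  obtain ⟨c, hc, hcS, hmax⟩ := isCompact_Icc.exists_sSup_image_eq_and_ge
    (Set.nonempty_Icc.2 hT.le) hzc
  change T ≥ 2 * sSup ((fun s => |z s|) '' Set.Icc (0:ℝ) T) / Mtilde at hTM
  rw [hcS] at hTM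
  have h1 := sup_sq T Mtilde |z c| c hMtilde z g (abs_nonneg _) hz hbound hc rfl
    (by rw [← mul_div_assoc]; exact hTM)
  have hlow : ∀ i ≤ n, 0 ≤ t i := by
    intro i
    induction i with
    | zero => intro _; exact ht0.ge
    | succ k ih => intro hk; exact (ih (by omega)).trans (hmonot k (by omega))
  have hhigh : ∀ k ≤ n, t (n - k) ≤ T := by
    intro k
    induction k with
    | zero => intro _; exact htn.le
    | succ k ih =>
      intro hk
      have h2 := hmonot (n - (k + 1)) (by omega)
      rw [show n - (k + 1) + 1 = n - k by omega] at h2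
      exact h2.trans (ih (by omega))
  have hhigh' : ∀ i ≤ n, t i ≤ T := by
    intro i hi
    have := hhigh (n - i) (by omega)
    rwa [show n - (n - i) = i by omega] at this
  have hsub : ∀ i < n, Set.Icc (t i) (t (i + 1)) ⊆ Set.Icc 0 T := fun i hi =>
    Set.Icc_subset_Icc (hlow i hi.le) (hhigh' (i + 1) hi)
  have hsum : ∑ i ∈ Finset.range n, ∫ s in (t i)..(t (i + 1)), |g s| = ∫ s in (0:ℝ)..T, |g s| := by
    rw [intervalIntegral.sum_integral_adjacent_intervals, ht0, htn]
    intro i hi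
    apply ContinuousOn.intervalIntegrable
    rw [Set.uIcc_of_le (hmonot i hi)]
    exact (hcont.mono (hsub i hi)).abs
  have h2 : ∫ s in (0:ℝ)..T, |g s| ≤ n * (2 * |z c|) := by
    rw [← hsum]
    have := Finset.sum_le_card_nsmul (Finset.range n)
      (fun i => ∫ s in (t i)..(t (i + 1)), |g s|) (2 * |z c|) (fun i hi => by
        have hi := Finset.mem_range.1 hi
        exact piece_le _ _ _ (hmonot i hi) z g (fun s hs => hz s (hsub i hi hs))
          (hcont.mono (hsub i hi)) (hpiece i hi) (fun s hs => hmax s (hsub i hi hs)))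
    simpa using this
  have h3 : 0 ≤ ∫ s in (0:ℝ)..T, |g s| :=
    intervalIntegral.integral_nonneg hT.le (fun s _ => abs_nonneg _)
  have h4 : |z c| ^ 2 ≤ (∫ s in (0:ℝ)..T, |z s|) * (2 * Mtilde) :=
    (div_le_iff₀ (by positivity)).1 h1
  calc (∫ s in (0:ℝ)..T, |g s|) ^ 2 ≤ (n * (2 * |z c|)) ^ 2 := pow_le_pow_left₀ h3 h2 2
    _ = 4 * (n : ℝ) ^ 2 * |z c| ^ 2 := by ring
    _ ≤ 4 * (n : ℝ) ^ 2 * ((∫ s in (0:ℝ)..T, |z s|) * (2 * Mtilde)) := by gcongr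
    _ = 8 * (n : ℝ) ^ 2 * Mtilde * ∫ s in (0:ℝ)..T, |z s| := by ring
end

section
/- Under the assumptions of the previous statement — T > 0, M̃ > 0, n ≥ 1, x'(t) = f(x(t)) and x̂'(t) = f̂(x̂(t)) on [0,T], z := x − x̂ continuously differentiable with |z'| ≤ M̃ on [0,T], z monotone on each of the n subintervals of a partition 0 = t₀ ≤ … ≤ tₙ = T, and T ≥ 2 sup_{[0,T]}|z| / M̃ — assume additionally that M := sup_{t ∈ [0,T]} |z(t)| > 0. Then ∫₀ᵀ |f(x(t)) − f̂(x̂(t))| dt ≤ (4 n M̃ / M) · ∫₀ᵀ |x(t) − x̂(t)| dt. -/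
theorem aux_piece (z g : ℝ → ℝ) (a b : ℝ) (hab : a ≤ b)
    (hz : ∀ s ∈ Set.Icc a b, HasDerivAt z (g s) s)
    (hg : ContinuousOn g (Set.Icc a b)) (hm : MonotoneOn z (Set.Icc a b)) :
    ∫ s in a..b, |g s| = z b - z a := by
  rcases hab.eq_or_lt with rfl | hlt
  · simp
  have hnn : ∀ s ∈ Set.Icc a b, 0 ≤ g s := by
    intro s hs
    have h1 := (hz s hs).hasDerivWithinAt (s := Set.Icc a b)
    rw [← h1.derivWithin (uniqueDiffOn_Icc hlt s hs)]
    exact hm.derivWithin_nonneg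
  have : ∫ s in a..b, |g s| = ∫ s in a..b, g s := by
    apply intervalIntegral.integral_congr
    intro s hs
    rw [Set.uIcc_of_le hab] at hs
    exact abs_of_nonneg (hnn s hs)
  rw [this]
  apply intervalIntegral.integral_eq_sub_of_hasDerivAt
  · intro s hs
    rw [Set.uIcc_of_le hab] at hs
    exact hz s hs
  · exact ContinuousOn.intervalIntegrable (by rwa [Set.uIcc_of_le hab])

theorem aux_piece_anti (z g : ℝ → ℝ) (a b : ℝ) (hab : a ≤ b)
    (hz : ∀ s ∈ Set.Icc a b, HasDerivAt z (g s) s)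
    (hg : ContinuousOn g (Set.Icc a b)) (hm : AntitoneOn z (Set.Icc a b)) :
    ∫ s in a..b, |g s| = z a - z b := by
  have := aux_piece (fun s => - z s) (fun s => - g s) a b hab
    (fun s hs => (hz s hs).neg) hg.neg hm.neg
  simp only [abs_neg] at this
  rw [this]; ring

theorem aux_lin (c k a b : ℝ) :
    ∫ s in a..b, (c + k * s) = c * (b - a) + k * (b ^ 2 - a ^ 2) / 2 := by
  rw [intervalIntegral.integral_add (by simp)
    (Continuous.intervalIntegrable (by fun_prop) _ _)]
  rw [intervalIntegral.integral_const_mul, integral_id]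
  simp; ring

theorem aux_sub (z : ℝ → ℝ) (T c k a b : ℝ) (h0 : 0 ≤ a) (hab : a ≤ b) (hb : b ≤ T)
    (hz : ContinuousOn z (Set.Icc 0 T))
    (hle : ∀ s ∈ Set.Icc a b, c + k * s ≤ |z s|) :
    c * (b - a) + k * (b ^ 2 - a ^ 2) / 2 ≤ ∫ s in (0:ℝ)..T, |z s| := by
  have hi : IntervalIntegrable (fun s => |z s|) MeasureTheory.volume 0 T := by
    apply ContinuousOn.intervalIntegrable
    rw [Set.uIcc_of_le (by linarith)]
    exact hz.abs
  rw [← aux_lin]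
  calc _ ≤ ∫ s in a..b, |z s| := by
        apply intervalIntegral.integral_mono_on hab
        · exact (continuous_const.add (continuous_const.mul continuous_id)).intervalIntegrable _ _
        · apply hi.mono_set
          rw [Set.uIcc_of_le hab, Set.uIcc_of_le (by linarith)]
          exact Set.Icc_subset_Icc h0 hb
        · exact hle
    _ ≤ _ := by
        apply intervalIntegral.integral_mono_interval h0 hab hb _ hi
        exact Filter.Eventually.of_forall fun s => abs_nonneg _

/-- Theorem 2 of the paper in linear form, with explicit constant `C = 4 n M̃ / M`:
`∫₀ᵀ |f(x(·)) − f̂(x̂(·))| ≤ (4 n M̃ / M) ∫₀ᵀ |x − x̂|`, where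
`M = sup_{[0,T]} |x − x̂| > 0`. -/
theorem stmt_9 (T Mtilde : ℝ) (hT : 0 < T) (hMtilde : 0 < Mtilde)
    (n : ℕ) (hn : 1 ≤ n) (f fhat x xhat : ℝ → ℝ)
    (hx : ∀ t ∈ Set.Icc (0:ℝ) T, HasDerivAt x (f (x t)) t)
    (hxhat : ∀ t ∈ Set.Icc (0:ℝ) T, HasDerivAt xhat (fhat (xhat t)) t)
    (hcont : ContinuousOn (fun t => f (x t) - fhat (xhat t)) (Set.Icc (0:ℝ) T))
    (hbound : ∀ t ∈ Set.Icc (0:ℝ) T, |f (x t) - fhat (xhat t)| ≤ Mtilde)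
    (t : ℕ → ℝ) (ht0 : t 0 = 0) (htn : t n = T)
    (hmonot : ∀ i < n, t i ≤ t (i + 1))
    (hpiece : ∀ i < n,
      MonotoneOn (fun s => x s - xhat s) (Set.Icc (t i) (t (i + 1))) ∨
        AntitoneOn (fun s => x s - xhat s) (Set.Icc (t i) (t (i + 1))))
    (M : ℝ) (hM : M = sSup ((fun s => |x s - xhat s|) '' Set.Icc (0:ℝ) T))
    (hTM : T ≥ 2 * M / Mtilde) (hMpos : 0 < M) :
    (∫ s in (0:ℝ)..T, |f (x s) - fhat (xhat s)|)
      ≤ (4 * (n : ℝ) * Mtilde / M) * ∫ s in (0:ℝ)..T, |x s - xhat s| := by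
  set z : ℝ → ℝ := fun s => x s - xhat s with hzdef
  set g : ℝ → ℝ := fun s => f (x s) - fhat (xhat s) with hgdef
  change ∫ s in (0:ℝ)..T, |g s| ≤ (4 * (n : ℝ) * Mtilde / M) * ∫ s in (0:ℝ)..T, |z s|
  have hz : ∀ s ∈ Set.Icc (0:ℝ) T, HasDerivAt z (g s) s :=
    fun s hs => (hx s hs).sub (hxhat s hs)
  have hzc : ContinuousOn z (Set.Icc 0 T) :=
    fun s hs => (hz s hs).continuousAt.continuousWithinAt
  have hne : (Set.Icc (0:ℝ) T).Nonempty := ⟨0, le_refl _, hT.le⟩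
  have hle : ∀ s ∈ Set.Icc (0:ℝ) T, |z s| ≤ M := by
    intro s hs
    rw [hM]
    exact le_csSup (isCompact_Icc.image_of_continuousOn hzc.abs).bddAbove ⟨s, hs, rfl⟩
  obtain ⟨s0, hs0, hs0M⟩ : ∃ s0 ∈ Set.Icc (0:ℝ) T, |z s0| = M := by
    have := (isCompact_Icc.image_of_continuousOn hzc.abs).sSup_mem (hne.image _)
    obtain ⟨s, hs, h⟩ := this
    exact ⟨s, hs, h.trans hM.symm⟩
  have hlip : ∀ s ∈ Set.Icc (0:ℝ) T, M - Mtilde * |s - s0| ≤ |z s| := by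
    intro s hs
    have h := (convex_Icc (0:ℝ) T).norm_image_sub_le_of_norm_hasDerivWithin_le
      (fun u hu => (hz u hu).hasDerivWithinAt) (C := Mtilde) (fun u hu => hbound u hu) hs hs0
    simp only [Real.norm_eq_abs] at h
    have h2 := abs_sub_abs_le_abs_sub (z s0) (z s)
    rw [abs_sub_comm s0 s] at h
    linarith
  have key : M ^ 2 ≤ 2 * Mtilde * ∫ s in (0:ℝ)..T, |z s| := by
    obtain ⟨d, hd⟩ : ∃ d, d = M / Mtilde := ⟨_, rfl⟩
    have hMd : M = Mtilde * d := by rw [hd]; field_simp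
    have hdpos : 0 < d := by rw [hd]; positivity
    have hT2 : 2 * d ≤ T := by rw [hd, ← mul_div_assoc]; exact hTM
    obtain ⟨h0, h1⟩ := hs0
    rcases le_total s0 (T / 2) with h | h
    · have := aux_sub z T (M + Mtilde * s0) (-Mtilde) s0 (s0 + d) h0 (by linarith) (by linarith)
        hzc (by
          intro s hs
          have := hlip s ⟨h0.trans hs.1, by linarith [hs.2]⟩
          rw [abs_of_nonneg (by linarith [hs.1])] at this
          linarith)
      have h3 := mul_le_mul_of_nonneg_left this (by positivity : 0 ≤ 2 * Mtilde)
      refine le_trans (le_of_eq ?_) h3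
      rw [hMd]; ring
    · have := aux_sub z T (M - Mtilde * s0) Mtilde (s0 - d) s0 (by linarith) (by linarith) h1
        hzc (by
          intro s hs
          have := hlip s ⟨by linarith [hs.1], by linarith [hs.2]⟩
          rw [abs_of_nonpos (by linarith [hs.2])] at this
          linarith)
      have h3 := mul_le_mul_of_nonneg_left this (by positivity : 0 ≤ 2 * Mtilde)
      refine le_trans (le_of_eq ?_) h3
      rw [hMd]; ring
  have hmono : ∀ j ≤ n, ∀ i ≤ j, t i ≤ t j := by
    intro j
    induction j with
    | zero => intro _ i hi; rw [Nat.le_zero.mp hi]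
    | succ k ih =>
      intro hk i hi
      rcases Nat.le_succ_iff.mp hi with h | h
      · exact (ih (by omega) i h).trans (hmonot k (by omega))
      · rw [h]
  have hsub : ∀ i < n, Set.Icc (t i) (t (i + 1)) ⊆ Set.Icc 0 T := by
    intro i hi
    apply Set.Icc_subset_Icc
    · rw [← ht0]; exact hmono i hi.le 0 (Nat.zero_le _)
    · rw [← htn]; exact hmono n le_rfl (i + 1) hi
  have hvar : ∫ s in (0:ℝ)..T, |g s| ≤ n * (2 * M) := by
    have hsum := intervalIntegral.sum_integral_adjacent_intervals (a := t) (n := n)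
      (f := fun s => |g s|) (μ := MeasureTheory.volume) (by
        intro i hi
        apply ContinuousOn.intervalIntegrable
        rw [Set.uIcc_of_le (hmonot i hi)]
        exact (hcont.mono (hsub i hi)).abs)
    rw [ht0, htn] at hsum
    rw [← hsum]
    have : ∀ i ∈ Finset.range n, ∫ s in (t i)..(t (i + 1)), |g s| ≤ 2 * M := by
      intro i hi
      have hi := Finset.mem_range.mp hi
      have ha := abs_le.mp (hle _ (hsub i hi (Set.left_mem_Icc.mpr (hmonot i hi))))
      have hb := abs_le.mp (hle _ (hsub i hi (Set.right_mem_Icc.mpr (hmonot i hi))))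
      rcases hpiece i hi with h | h
      · rw [aux_piece z g _ _ (hmonot i hi) (fun s hs => hz s (hsub i hi hs))
          (hcont.mono (hsub i hi)) h]
        linarith [ha.1, hb.2]
      · rw [aux_piece_anti z g _ _ (hmonot i hi) (fun s hs => hz s (hsub i hi hs))
          (hcont.mono (hsub i hi)) h]
        linarith [ha.2, hb.1]
    refine (Finset.sum_le_sum this).trans (le_of_eq ?_)
    simp
  refine hvar.trans ?_
  rw [div_mul_eq_mul_div, le_div_iff₀ hMpos]
  have h3 := mul_le_mul_of_nonneg_left key (by positivity : 0 ≤ 2 * (n : ℝ))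
  linarith
end

section
/- Let T > 0 and let u, u₁, ũ₁, u₂, ũ₂, x, x̃₁, x̃₂ : ℝ → ℝ be measurable functions such that u − u₁, u₁ − ũ₁, u − ũ₁, x − x̃₁ and x − x̃₂ are integrable on [0,T], and x − x̃₂, u − ũ₂, ũ₂ − u₂ and u − u₂ are square-integrable on [0,T]. Let C ≥ 0, λ ≥ 0 and k₁, k₂ ≥ 0 be real constants, and set ν₂ := ( ∫₀ᵀ (ũ₂(t) − u₂(t))² dt )^{1/2}. Assume: (H1) ∫₀ᵀ |u₁(t) − ũ₁(t)| dt ≤ C λ k₁; (H2) ∫₀ᵀ |u(t) − ũ₁(t)| dt ≤ C ∫₀ᵀ |x(t) − x̃₁(t)| dt; (H3) λ k₁ + ∫₀ᵀ |x(t) − x̃₁(t)| dt ≤ λ k₂ + ∫₀ᵀ |x(t) − x̃₂(t)| dt; (H4) ( ∫₀ᵀ (x(t) − x̃₂(t))² dt )^{1/2} ≤ T ( ∫₀ᵀ (u(t) − ũ₂(t))² dt )^{1/2}. Then ∫₀ᵀ |u(t) − u₁(t)| dt ≤ C λ k₂ + C T^{3/2} ν₂ + C T^{3/2} ( ∫₀ᵀ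 (u(t) − u₂(t))² dt )^{1/2}. -/
open MeasureTheory in
theorem aux_cs (T : ℝ) (hT : 0 < T) (a b : ℝ → ℝ)
    (ha : IntervalIntegrable (fun s => a s ^ 2) volume 0 T)
    (hb : IntervalIntegrable (fun s => b s ^ 2) volume 0 T)
    (hab : IntervalIntegrable (fun s => a s * b s) volume 0 T) :
    (∫ s in (0:ℝ)..T, a s * b s) ≤
      Real.sqrt (∫ s in (0:ℝ)..T, a s ^ 2) * Real.sqrt (∫ s in (0:ℝ)..T, b s ^ 2) := by
  have hA : 0 ≤ ∫ s in (0:ℝ)..T, a s ^ 2 :=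
    intervalIntegral.integral_nonneg hT.le (fun s _ => sq_nonneg _)
  have key : ∀ r : ℝ, 0 ≤ (∫ s in (0:ℝ)..T, a s ^ 2) * (r * r)
      + (2 * ∫ s in (0:ℝ)..T, a s * b s) * r + ∫ s in (0:ℝ)..T, b s ^ 2 := by
    intro r
    have h : 0 ≤ ∫ s in (0:ℝ)..T, ((r * r) * a s ^ 2 + (2 * r) * (a s * b s)) + b s ^ 2 :=
      intervalIntegral.integral_nonneg hT.le (fun s _ => by nlinarith [sq_nonneg (r * a s + b s)])
    rw [intervalIntegral.integral_add ((ha.const_mul _).add (hab.const_mul _)) hb,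
      intervalIntegral.integral_add (ha.const_mul _) (hab.const_mul _),
      intervalIntegral.integral_const_mul, intervalIntegral.integral_const_mul] at h
    linarith
  have hd := discrim_le_zero key
  unfold discrim at hd
  rw [← Real.sqrt_mul hA]
  apply Real.le_sqrt_of_sq_le
  nlinarith

/-- Theorem 3 of the paper (Model Selection), with the objects of its proof made
explicit: under hypotheses (H1)–(H4),
`∫₀ᵀ |u − u₁| ≤ C λ k₂ + C T^{3/2} ν₂ + C T^{3/2} (∫₀ᵀ (u − u₂)²)^{1/2}`. -/
theorem stmt_10 (T : ℝ) (hT : 0 < T)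
    (u u1 ut1 u2 ut2 x xt1 xt2 : ℝ → ℝ)
    (hmeas : Measurable u ∧ Measurable u1 ∧ Measurable ut1 ∧ Measurable u2 ∧
      Measurable ut2 ∧ Measurable x ∧ Measurable xt1 ∧ Measurable xt2)
    (hi1 : IntervalIntegrable (fun s => u s - u1 s) MeasureTheory.volume 0 T)
    (hi2 : IntervalIntegrable (fun s => u1 s - ut1 s) MeasureTheory.volume 0 T)
    (hi3 : IntervalIntegrable (fun s => u s - ut1 s) MeasureTheory.volume 0 T)
    (hi4 : IntervalIntegrable (fun s => x s - xt1 s) MeasureTheory.volume 0 T)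
    (hi5 : IntervalIntegrable (fun s => x s - xt2 s) MeasureTheory.volume 0 T)
    (hs1 : IntervalIntegrable (fun s => (x s - xt2 s) ^ 2) MeasureTheory.volume 0 T)
    (hs2 : IntervalIntegrable (fun s => (u s - ut2 s) ^ 2) MeasureTheory.volume 0 T)
    (hs3 : IntervalIntegrable (fun s => (ut2 s - u2 s) ^ 2) MeasureTheory.volume 0 T)
    (hs4 : IntervalIntegrable (fun s => (u s - u2 s) ^ 2) MeasureTheory.volume 0 T)
    (C lam k1 k2 : ℝ) (hC : 0 ≤ C) (hlam : 0 ≤ lam) (hk1 : 0 ≤ k1) (hk2 : 0 ≤ k2)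
    (nu2 : ℝ) (hnu2 : nu2 = Real.sqrt (∫ s in (0:ℝ)..T, (ut2 s - u2 s) ^ 2))
    (H1 : (∫ s in (0:ℝ)..T, |u1 s - ut1 s|) ≤ C * lam * k1)
    (H2 : (∫ s in (0:ℝ)..T, |u s - ut1 s|) ≤ C * ∫ s in (0:ℝ)..T, |x s - xt1 s|)
    (H3 : lam * k1 + (∫ s in (0:ℝ)..T, |x s - xt1 s|)
        ≤ lam * k2 + ∫ s in (0:ℝ)..T, |x s - xt2 s|)
    (H4 : Real.sqrt (∫ s in (0:ℝ)..T, (x s - xt2 s) ^ 2)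
        ≤ T * Real.sqrt (∫ s in (0:ℝ)..T, (u s - ut2 s) ^ 2)) :
    (∫ s in (0:ℝ)..T, |u s - u1 s|)
      ≤ C * lam * k2 + C * T ^ ((3:ℝ)/2) * nu2
        + C * T ^ ((3:ℝ)/2) * Real.sqrt (∫ s in (0:ℝ)..T, (u s - u2 s) ^ 2) := by
  have t1 : (∫ s in (0:ℝ)..T, |u s - u1 s|) ≤
      (∫ s in (0:ℝ)..T, |u s - ut1 s|) + ∫ s in (0:ℝ)..T, |u1 s - ut1 s| := by
    rw [← intervalIntegral.integral_add hi3.abs hi2.abs]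
    apply intervalIntegral.integral_mono_on hT.le hi1.abs (hi3.abs.add hi2.abs)
    intro s _
    have := abs_sub (u s - ut1 s) (u1 s - ut1 s)
    simpa using this
  have t2 : (∫ s in (0:ℝ)..T, |x s - xt2 s|) ≤
      Real.sqrt (∫ s in (0:ℝ)..T, (x s - xt2 s) ^ 2) * Real.sqrt T := by
    have := aux_cs T hT (fun s => |x s - xt2 s|) (fun _ => 1) (by simpa using hs1)
      (by simp) (by simpa using hi5.abs)
    simpa using this
  have t3 : Real.sqrt (∫ s in (0:ℝ)..T, (u s - ut2 s) ^ 2) ≤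
      nu2 + Real.sqrt (∫ s in (0:ℝ)..T, (u s - u2 s) ^ 2) := by
    have hp : IntervalIntegrable (fun s => (ut2 s - u2 s) * (u2 s - u s))
        MeasureTheory.volume 0 T := by
      refine (((hs2.sub hs3).sub hs4).const_mul (1 / 2)).congr ?_
      refine fun s _ => ?_
      simp only
      ring
    have hs4' : IntervalIntegrable (fun s => (u2 s - u s) ^ 2) MeasureTheory.volume 0 T :=
      hs4.congr (fun s _ => by ring)
    have hc := aux_cs T hT (fun s => ut2 s - u2 s) (fun s => u2 s - u s) hs3 hs4' hp
    have e4 : (∫ s in (0:ℝ)..T, (u2 s - u s) ^ 2) = ∫ s in (0:ℝ)..T, (u s - u2 s) ^ 2 := by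
      congr 1; ext s; ring
    have e : (∫ s in (0:ℝ)..T, (u s - ut2 s) ^ 2) =
        (∫ s in (0:ℝ)..T, (ut2 s - u2 s) ^ 2) + (∫ s in (0:ℝ)..T, (u s - u2 s) ^ 2)
          + 2 * ∫ s in (0:ℝ)..T, (ut2 s - u2 s) * (u2 s - u s) := by
      rw [← intervalIntegral.integral_const_mul, ← intervalIntegral.integral_add hs3 hs4,
        ← intervalIntegral.integral_add (hs3.add hs4) (hp.const_mul 2)]
      congr 1; ext s; ring
    simp only [e4] at hc
    have n3 : 0 ≤ ∫ s in (0:ℝ)..T, (ut2 s - u2 s) ^ 2 :=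
      intervalIntegral.integral_nonneg hT.le (fun s _ => sq_nonneg _)
    have n4 : 0 ≤ ∫ s in (0:ℝ)..T, (u s - u2 s) ^ 2 :=
      intervalIntegral.integral_nonneg hT.le (fun s _ => sq_nonneg _)
    rw [hnu2]
    apply Real.sqrt_le_iff.mpr ⟨by positivity, ?_⟩
    nlinarith [Real.sq_sqrt n3, Real.sq_sqrt n4]
  have e32 : T ^ ((3:ℝ)/2) = T * Real.sqrt T := by
    rw [Real.sqrt_eq_rpow, show (3:ℝ)/2 = 1 + 1/2 by norm_num, Real.rpow_add hT, Real.rpow_one]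
  have t4 : (∫ s in (0:ℝ)..T, |x s - xt2 s|) ≤
      T ^ ((3:ℝ)/2) * (nu2 + Real.sqrt (∫ s in (0:ℝ)..T, (u s - u2 s) ^ 2)) := by
    calc _ ≤ _ := t2
      _ ≤ (T * (nu2 + Real.sqrt (∫ s in (0:ℝ)..T, (u s - u2 s) ^ 2))) * Real.sqrt T := by
        gcongr
        exact H4.trans (by gcongr)
      _ = _ := by rw [e32]; ring
  have t5 := mul_le_mul_of_nonneg_left (H3.trans (add_le_add_right t4 (lam * k2))) hC
  linarith
end
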